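/- Let K = K(n,m,Λ) be a Bedford–McMullen carpet with 2 ≤ N ≤ n−1, let y ∈ π₂(K), set α = log N / log n, suppose 0 < H^α(K^y) < ∞, and let h : ℝ → ℝ be a similitude with similarity ratio ρ ∈ (0,1) such that h(K^y) ⊆ K^y. Then there exist a left isolated point a of K^y and a right isolated point b of K^y such that: if h is orientation-preserving (h(x) = ρx + c), then h(a) is a left isolated point and h(b) is a right isolated point of K^y; if h is orientation-reversing (h(x) = −ρx + c), then h(b) is a left isolated point and h(a) is a right isolated point of K^y. -/

import Mathlib

open scoped BigOperators

/-- The Bedford–McMullen carpet `K(n,m,Λ)`: the set of points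
`(Σ_k i_k n^{-k}, Σ_k j_k m^{-k})` with `(i_k, j_k) ∈ Λ` for all `k ≥ 1`. -/
def BMCarpet (n m : ℕ) (Λ : Finset (ℕ × ℕ)) : Set (ℝ × ℝ) :=
  { p | ∃ d : ℕ → ℕ × ℕ, (∀ k, d k ∈ Λ) ∧
      p.1 = ∑' k : ℕ, ((d k).1 : ℝ) / (n : ℝ) ^ (k + 1) ∧
      p.2 = ∑' k : ℕ, ((d k).2 : ℝ) / (m : ℝ) ^ (k + 1) }

/-- `f` is a similitude of the Euclidean plane with ratio `l`. -/
def IsSimilitude (f : ℝ × ℝ → ℝ × ℝ) (l : ℝ) : Prop :=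
  ∀ x y : ℝ × ℝ,
    Real.sqrt (((f x).1 - (f y).1) ^ 2 + ((f x).2 - (f y).2) ^ 2)
      = l * Real.sqrt ((x.1 - y.1) ^ 2 + (x.2 - y.2) ^ 2)

/-- `f` is oblique: both coordinates of `f (1,0) - f (0,0)` are nonzero. -/
def Oblique (f : ℝ × ℝ → ℝ × ℝ) : Prop :=
  (f (1, 0)).1 - (f (0, 0)).1 ≠ 0 ∧ (f (1, 0)).2 - (f (0, 0)).2 ≠ 0

/-- `K` is contained in some affine line of the plane. -/
def OnALine (K : Set (ℝ × ℝ)) : Prop :=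
  ∃ a b c : ℝ, (a ≠ 0 ∨ b ≠ 0) ∧ ∀ p ∈ K, a * p.1 + b * p.2 = c

/-- `I_j`: the digits of selected rectangles in the `j`-th row. -/
def rowDigits (Λ : Finset (ℕ × ℕ)) (j : ℕ) : Finset ℕ :=
  (Λ.filter fun p => p.2 = j).image Prod.fst

/-- `N = max_{0 ≤ j ≤ m-1} card I_j`. -/
def maxRowCard (m : ℕ) (Λ : Finset (ℕ × ℕ)) : ℕ :=
  Finset.sup (Finset.range m) fun j => (rowDigits Λ j).card

/-- The horizontal slice `K^y = { x : (x,y) ∈ K }`. -/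
def horizSlice (K : Set (ℝ × ℝ)) (y : ℝ) : Set ℝ := { x | (x, y) ∈ K }

/-- `a` is a left isolated point of `A`. -/
def LeftIsolated (A : Set ℝ) (a : ℝ) : Prop :=
  a ∈ A ∧ ∃ r > 0, Set.Ioo (a - r) a ∩ A = ∅

/-- `a` is a right isolated point of `A`. -/
def RightIsolated (A : Set ℝ) (a : ℝ) : Prop :=
  a ∈ A ∧ ∃ r > 0, Set.Ioo a (a + r) ∩ A = ∅

open MeasureTheory

/-- The number `0.d₀d₁d₂…` in base `n`. -/
noncomputable def digitSum (n : ℕ) (d : ℕ → ℕ) : ℝ := ∑' k : ℕ, (d k : ℝ) / (n : ℝ) ^ (k + 1)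

/-- The integer with base `n` digits `d₀ d₁ … d_{k-1}`, leading digit first. -/
def digitPrefix (n : ℕ) (d : ℕ → ℕ) : ℕ → ℕ
  | 0 => 0
  | k + 1 => n * digitPrefix n d k + d k

/-- The numbers whose `k`-th base `n` digit is taken from `S k`. -/
def digitSet (n : ℕ) (S : ℕ → Finset ℕ) : Set ℝ := digitSum n '' {d | ∀ k, d k ∈ S k}

theorem hasSum_max_digits {n : ℕ} (hn : 2 ≤ n) :
    HasSum (fun k : ℕ => ((n : ℝ) - 1) / (n : ℝ) ^ (k + 1)) 1 := by
  have hn' : (2 : ℝ) ≤ n := by exact_mod_cast hn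
  have h := (hasSum_geometric_of_lt_one (r := (n : ℝ)⁻¹) (by positivity)
    (inv_lt_one_of_one_lt₀ (by linarith))).mul_left (((n : ℝ) - 1) / n)
  convert h using 1
  · rfl
  · funext k
    rw [pow_succ, inv_pow]
    field_simp
  · have : (n : ℝ) - 1 ≠ 0 := by linarith
    field_simp

theorem hasSum_const_digit {n : ℕ} (hn : 2 ≤ n) (c : ℕ) :
    HasSum (fun k : ℕ => (c : ℝ) / (n : ℝ) ^ (k + 1)) (c / ((n : ℝ) - 1)) := by
  have hn' : (2 : ℝ) ≤ n := by exact_mod_cast hn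
  have : (n : ℝ) - 1 ≠ 0 := by linarith
  convert (hasSum_max_digits hn).mul_left ((c : ℝ) / ((n : ℝ) - 1)) using 1
  · rfl
  · funext k
    field_simp
  · ring

theorem digit_div_le {n : ℕ} {c : ℕ} (hc : c < n) (k : ℕ) :
    (c : ℝ) / (n : ℝ) ^ (k + 1) ≤ ((n : ℝ) - 1) / (n : ℝ) ^ (k + 1) := by
  have : (c : ℝ) + 1 ≤ n := by exact_mod_cast hc
  gcongr
  linarith

theorem summable_digits {n : ℕ} (hn : 2 ≤ n) {d : ℕ → ℕ} (hd : ∀ k, d k < n) :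
    Summable fun k : ℕ => (d k : ℝ) / (n : ℝ) ^ (k + 1) :=
  Summable.of_nonneg_of_le (fun k => by positivity) (fun k => digit_div_le (hd k) k)
    (hasSum_max_digits hn).summable

theorem digitSum_nonneg (n : ℕ) (d : ℕ → ℕ) : 0 ≤ digitSum n d :=
  tsum_nonneg fun k => by positivity

theorem digitSum_mono {n : ℕ} (hn : 2 ≤ n) {d e : ℕ → ℕ} (he : ∀ k, e k < n)
    (h : ∀ k, d k ≤ e k) : digitSum n d ≤ digitSum n e :=
  Summable.tsum_le_tsum (fun k => by have := h k; gcongr)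
    (summable_digits hn fun k => (h k).trans_lt (he k)) (summable_digits hn he)

theorem digitSum_one_sub {n : ℕ} (hn : 2 ≤ n) {d : ℕ → ℕ} (hd : ∀ k, d k < n) :
    digitSum n (fun k => n - 1 - d k) = 1 - digitSum n d := by
  refine HasSum.tsum_eq ?_
  convert (hasSum_max_digits hn).sub (summable_digits hn hd).hasSum using 1
  · rfl
  · funext k
    have := hd k
    rw [Nat.cast_sub (by omega), Nat.cast_sub (by omega), Nat.cast_one]
    ring
  · rfl

theorem digitSum_le_one {n : ℕ} (hn : 2 ≤ n) {d : ℕ → ℕ} (hd : ∀ k, d k < n) :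
    digitSum n d ≤ 1 := by
  have := digitSum_nonneg n fun k => n - 1 - d k
  rw [digitSum_one_sub hn hd] at this
  linarith

theorem digitSum_succ {n : ℕ} (hn : 2 ≤ n) {d : ℕ → ℕ} (hd : ∀ k, d k < n) :
    digitSum n d = (d 0 + digitSum n fun l => d (l + 1)) / n := by
  have hn' : (2 : ℝ) ≤ n := by exact_mod_cast hn
  rw [digitSum, (summable_digits hn hd).tsum_eq_zero_add, digitSum, add_div, ← tsum_div_const]
  simp only [zero_add, pow_one]
  congr 2
  funext k
  rw [pow_succ]
  field_simp

theorem digitSum_split {n : ℕ} (hn : 2 ≤ n) {d : ℕ → ℕ} (hd : ∀ k, d k < n) (k : ℕ) :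
    digitSum n d = (digitPrefix n d k + digitSum n fun l => d (l + k)) / (n : ℝ) ^ k := by
  have hn' : (2 : ℝ) ≤ n := by exact_mod_cast hn
  induction k with
  | zero => simp [digitPrefix]
  | succ k ih =>
    rw [ih, digitSum_succ hn fun l => hd (l + k), digitPrefix]
    simp only [zero_add, add_assoc, add_comm 1 k]
    push_cast
    field_simp
    ring

theorem digitPrefix_congr {n : ℕ} {d e : ℕ → ℕ} {k : ℕ} (h : ∀ l < k, d l = e l) :
    digitPrefix n d k = digitPrefix n e k := by
  induction k with
  | zero => rfl
  | succ k ih =>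
    rw [digitPrefix, digitPrefix, ih fun l hl => h l (hl.trans k.lt_succ_self), h k k.lt_succ_self]

theorem eq_zero_of_digitSum_eq_zero {n : ℕ} (hn : 2 ≤ n) {d : ℕ → ℕ} (hd : ∀ k, d k < n)
    (h : digitSum n d = 0) (k : ℕ) : d k = 0 := by
  have h1 := (summable_digits hn hd).hasSum
  rw [← digitSum, h, hasSum_zero_iff_of_nonneg fun k => by positivity] at h1
  have h2 := congrFun h1 k
  have : (n : ℝ) ≠ 0 := by positivity
  simpa [this] using h2

theorem eq_max_of_digitSum_eq_one {n : ℕ} (hn : 2 ≤ n) {d : ℕ → ℕ} (hd : ∀ k, d k < n)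
    (h : digitSum n d = 1) (k : ℕ) : d k = n - 1 := by
  have h1 := digitSum_one_sub hn hd
  rw [h, sub_self] at h1
  have h2 := eq_zero_of_digitSum_eq_zero hn (fun k => by omega) h1 k
  have := hd k
  omega

theorem digits_of_digitSum_eq_of_lt {n : ℕ} (hn : 2 ≤ n) {d e : ℕ → ℕ} (hd : ∀ k, d k < n)
    (he : ∀ k, e k < n) (h : digitSum n d = digitSum n e) {k : ℕ} (hk : ∀ l < k, d l = e l)
    (hlt : e k < d k) : ∀ l, k < l → d l = 0 ∧ e l = n - 1 := by
  have hn' : (0 : ℝ) < n := by positivity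
  rw [digitSum_split hn hd (k + 1), digitSum_split hn he (k + 1),
    div_left_inj' (by positivity), digitPrefix, digitPrefix, digitPrefix_congr hk] at h
  push_cast at h
  have h1 : (e k : ℝ) + 1 ≤ d k := by exact_mod_cast hlt
  have h2 := digitSum_nonneg n fun l => d (l + (k + 1))
  have h3 := digitSum_le_one hn fun l => he (l + (k + 1))
  intro l hl
  obtain ⟨l, rfl⟩ := Nat.exists_eq_add_of_lt hl
  have h4 := eq_zero_of_digitSum_eq_zero hn (fun l => hd (l + (k + 1))) (by linarith) l
  have h5 := eq_max_of_digitSum_eq_one hn (fun l => he (l + (k + 1))) (by linarith) l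
  rw [show k + l + 1 = l + (k + 1) by ring]
  exact ⟨h4, h5⟩

theorem digits_of_digitSum_eq {n : ℕ} (hn : 2 ≤ n) {d e : ℕ → ℕ} (hd : ∀ k, d k < n)
    (he : ∀ k, e k < n) (h : digitSum n d = digitSum n e) (hne : d ≠ e) :
    ∃ k, (∀ l, k < l → d l = 0 ∧ e l = n - 1) ∨ ∀ l, k < l → e l = 0 ∧ d l = n - 1 := by
  classical
  have hex : ∃ k, d k ≠ e k := Function.ne_iff.mp hne
  have hk : ∀ l < Nat.find hex, d l = e l := fun l hl => not_not.mp (Nat.find_min hex hl)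
  refine ⟨Nat.find hex, ?_⟩
  rcases lt_or_gt_of_ne (Nat.find_spec hex) with hlt | hlt
  · exact Or.inr (digits_of_digitSum_eq_of_lt hn he hd h.symm (fun l hl => (hk l hl).symm) hlt)
  · exact Or.inl (digits_of_digitSum_eq_of_lt hn hd he h hk hlt)

/-- All digit sets `S k` are nonempty proper subsets of `{0, …, n - 1}`. -/
def ProperDigits (n : ℕ) (S : ℕ → Finset ℕ) : Prop :=
  ∀ k, (S k).Nonempty ∧ S k ⊂ Finset.range n

namespace ProperDigits

variable {n : ℕ} {S : ℕ → Finset ℕ}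

theorem lt (hS : ProperDigits n S) {k i : ℕ} (hi : i ∈ S k) : i < n :=
  Finset.mem_range.mp ((hS k).2.subset hi)

theorem tail (hS : ProperDigits n S) (k : ℕ) : ProperDigits n fun l => S (l + k) :=
  fun l => hS (l + k)

theorem two_le (hS : ProperDigits n S) : 2 ≤ n := by
  have h1 := Finset.card_lt_card (hS 0).2
  have h2 := (hS 0).1.card_pos
  rw [Finset.card_range] at h1
  omega

/-- Some digit of a proper digit set has no cyclic predecessor in it. -/
theorem exists_no_pred (hS : ProperDigits n S) (k : ℕ) :
    ∃ i ∈ S k, ∀ j ∈ S k, ∀ q : ℤ, (j : ℤ) + 1 ≠ i + n * q := by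
  by_contra! hcon
  have hlt : ∀ {i}, i ∈ S k → i < n := fun hi => hS.lt hi
  have hpred : ∀ i, i + 1 ∈ S k → i ∈ S k := by
    intro i hi
    obtain ⟨j, hj, q, hq⟩ := hcon _ hi
    have h1 := hlt hi
    have h2 := hlt hj
    have h3 : q < 1 := by
      by_contra! h
      have : (n : ℤ) * 1 ≤ n * q := by gcongr
      push_cast at hq
      omega
    have h4 : -1 < q := by
      by_contra! h
      have : (n : ℤ) * q ≤ n * (-1) := by gcongr
      push_cast at hq
      omega
    obtain rfl : q = 0 := by omega
    push_cast at hq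
    obtain rfl : j = i := by omega
    exact hj
  have hdown : ∀ t i, i + t ∈ S k → i ∈ S k := by
    intro t
    induction t with
    | zero => exact fun i hi => hi
    | succ t ih => exact fun i hi => ih i (hpred _ hi)
  obtain ⟨i, hi⟩ := (hS k).1
  have h0 : 0 ∈ S k := hdown i 0 (by simpa using hi)
  obtain ⟨j, hj, q, hq⟩ := hcon _ h0
  have h1 := hlt hj
  have h3 : q < 2 := by
    by_contra! h
    have : (n : ℤ) * 2 ≤ n * q := by gcongr
    push_cast at hq
    omega
  have h4 : 0 < q := by
    by_contra! h
    have : (n : ℤ) * q ≤ n * 0 := by gcongr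
    push_cast at hq
    omega
  obtain rfl : q = 1 := by omega
  refine (hS k).2.not_subset fun i hi => hdown (j - i) i ?_
  have := Finset.mem_range.mp hi
  push_cast at hq
  rwa [show i + (j - i) = j by omega]

/-- Splitting a point of a digit set at level `k`. -/
theorem exists_split (hS : ProperDigits n S) {x : ℝ} (hx : x ∈ digitSet n S) (k : ℕ) :
    ∃ d : ℕ → ℕ, (∀ l, d l ∈ S l) ∧ ∃ τ ∈ digitSet n fun l => S (l + k),
      x = (digitPrefix n d k + τ) / (n : ℝ) ^ k := by
  obtain ⟨d, hd, rfl⟩ := hx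
  exact ⟨d, hd, _, ⟨_, fun l => hd (l + k), rfl⟩,
    digitSum_split hS.two_le (fun l => hS.lt (hd l)) k⟩

theorem mem_of_split (hS : ProperDigits n S) {d : ℕ → ℕ} {k : ℕ} (hd : ∀ l < k, d l ∈ S l)
    {τ : ℝ} (hτ : τ ∈ digitSet n fun l => S (l + k)) :
    (digitPrefix n d k + τ) / (n : ℝ) ^ k ∈ digitSet n S := by
  obtain ⟨e, he, rfl⟩ := hτ
  have hmem : ∀ l, (if l < k then d l else e (l - k)) ∈ S l := by
    intro l
    split_ifs with h
    · exact hd l h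
    · simpa [Nat.sub_add_cancel (not_lt.mp h)] using he (l - k)
  refine ⟨_, hmem, ?_⟩
  rw [digitSum_split hS.two_le (fun l => hS.lt (hmem l)) k]
  rw [digitPrefix_congr fun l hl => if_pos hl]
  simp

theorem mem_Icc (hS : ProperDigits n S) {x : ℝ} (hx : x ∈ digitSet n S) : x ∈ Set.Icc 0 1 := by
  obtain ⟨d, hd, rfl⟩ := hx
  exact ⟨digitSum_nonneg n d, digitSum_le_one hS.two_le fun l => hS.lt (hd l)⟩

theorem isLeast (hS : ProperDigits n S) :
    IsLeast (digitSet n S) (digitSum n fun k => (S k).min' (hS k).1) := by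
  refine ⟨⟨_, fun k => Finset.min'_mem _ _, rfl⟩, ?_⟩
  rintro _ ⟨d, hd, rfl⟩
  exact digitSum_mono hS.two_le (fun k => hS.lt (hd k)) fun k => Finset.min'_le _ _ (hd k)

theorem isCompact (hS : ProperDigits n S) : IsCompact (digitSet n S) := by
  have h1 : IsCompact {d : ℕ → ℕ | ∀ k, d k ∈ S k} := by
    convert isCompact_univ_pi fun k => (S k).finite_toSet.isCompact using 1
    ext d
    simp
  refine h1.image_of_continuousOn (continuousOn_tsum (fun k => Continuous.continuousOn ?_)
    (hasSum_max_digits hS.two_le).summable fun k d hd => ?_)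
  · exact (continuous_of_discreteTopology.comp (continuous_apply k)).div_const _
  · rw [Real.norm_of_nonneg (by positivity)]
    exact digit_div_le (hS.lt (hd k)) k

theorem reflect (hS : ProperDigits n S) :
    ProperDigits n fun k => (S k).image fun i => n - 1 - i := by
  intro k
  refine ⟨(hS k).1.image _, Finset.ssubset_iff_subset_ne.mpr ⟨fun i hi => ?_, fun h => ?_⟩⟩
  · obtain ⟨j, hj, rfl⟩ := Finset.mem_image.mp hi
    have := hS.lt hj
    simp only [Finset.mem_range]
    omega
  · have h1 := Finset.card_lt_card (hS k).2
    have h2 := (Finset.card_image_le (s := S k) (f := fun i => n - 1 - i))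
    simp only at h
    rw [h] at h2
    omega

theorem image_one_sub (hS : ProperDigits n S) :
    (fun x => 1 - x) '' digitSet n S = digitSet n fun k => (S k).image fun i => n - 1 - i := by
  ext x
  constructor
  · rintro ⟨_, ⟨d, hd, rfl⟩, rfl⟩
    exact ⟨_, fun k => Finset.mem_image_of_mem _ (hd k),
      digitSum_one_sub hS.two_le fun k => hS.lt (hd k)⟩
  · rintro ⟨d, hd, rfl⟩
    have h1 : ∀ k, n - 1 - d k ∈ S k ∧ d k < n := by
      intro k
      obtain ⟨j, hj, hjd⟩ := Finset.mem_image.mp (hd k)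
      have := hS.lt hj
      rw [← hjd, show n - 1 - (n - 1 - j) = j by omega]
      exact ⟨hj, by omega⟩
    refine ⟨_, ⟨_, fun k => (h1 k).1, rfl⟩, ?_⟩
    simp only [digitSum_one_sub hS.two_le fun k => (h1 k).2, sub_sub_cancel]

end ProperDigits

/-- At every scale `n⁻ᵏ`, the points of `E` lying to the right of a gap of that size belong to a
translate of a lattice of comparable mesh. -/
def GapLattice (n : ℕ) (E : Set ℝ) : Prop :=
  ∃ D : ℕ, 0 < D ∧ ∃ t : ℕ → ℝ, ∃ k₀ : ℕ, ∀ k ≥ k₀, ∀ e ∈ E,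
    Set.Ioo (e - 1 / (n : ℝ) ^ k) e ∩ E = ∅ → ∃ Z : ℤ, e = t k + Z / (D * (n : ℝ) ^ (k + 1))

/-- Near `z`, at every small scale, `E` has a point with a gap of that scale to its left. -/
def HasGapsNear (n : ℕ) (E : Set ℝ) (z : ℝ) : Prop :=
  ∃ k₀ : ℕ, ∀ k ≥ k₀, ∃ a ∈ E, |a - z| ≤ 1 / (n : ℝ) ^ k ∧
    Set.Ioo (a - 1 / (n : ℝ) ^ (k + 1)) a ∩ E = ∅

/-- The subset `F` fills `E` up to arbitrarily small relative errors at small scales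
around `x`. -/
def DenselyFillsAt (n : ℕ) (F E : Set ℝ) (x : ℝ) : Prop :=
  ∀ L : ℕ, ∃ k₁ : ℕ, ∀ k ≥ k₁, ∀ e ∈ E, |e - x| ≤ 2 / (n : ℝ) ^ k →
    ∃ f ∈ F, |f - e| ≤ 1 / (n : ℝ) ^ (k + L)

theorem exists_int_separation (u : ℝ) : ∃ κ > 0, ∀ Z : ℤ, |u - Z| < κ → u = Z := by
  by_cases hu : ∃ Z : ℤ, u = Z
  · obtain ⟨Z₀, rfl⟩ := hu
    refine ⟨1, one_pos, fun Z hZ => ?_⟩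
    rw [← Int.cast_sub, ← Int.cast_abs] at hZ
    have : |Z₀ - Z| < 1 := by exact_mod_cast hZ
    rw [Int.abs_lt_one_iff, sub_eq_zero] at this
    rw [this]
  · push Not at hu
    refine ⟨|u - round u|, abs_pos.mpr (sub_ne_zero.mpr (hu _)), fun Z hZ => ?_⟩
    exact absurd (round_le u Z) (not_le.mpr hZ)

theorem exists_int_mul_separation (u : ℝ) (B : ℕ) :
    ∃ κ > 0, ∀ Z Z' : ℤ, |Z| ≤ B → |u * Z - Z'| < κ → u * Z = Z' := by
  choose κ hκ h using exists_int_separation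
  have hne : (Finset.Icc (-(B : ℤ)) B).Nonempty := ⟨0, by simp⟩
  obtain ⟨Z₀, -, hZ₀⟩ := Finset.exists_min_image _ (fun Z : ℤ => κ (u * Z)) hne
  refine ⟨κ (u * Z₀), hκ _, fun Z Z' hZ hlt => h _ _ (hlt.trans_le (hZ₀ Z ?_))⟩
  exact Finset.mem_Icc.mpr (abs_le.mp hZ)

theorem exists_one_div_pow_lt {n : ℕ} (hn : 2 ≤ n) {δ : ℝ} (hδ : 0 < δ) :
    ∃ L₀ : ℕ, ∀ L ≥ L₀, 1 / (n : ℝ) ^ L < δ := by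
  have hn' : (2 : ℝ) ≤ n := by exact_mod_cast hn
  obtain ⟨L₀, hL₀⟩ := exists_pow_lt_of_lt_one hδ (inv_lt_one_of_one_lt₀ (by linarith : 1 < (n : ℝ)))
  refine ⟨L₀, fun L hL => lt_of_le_of_lt ?_ hL₀⟩
  rw [inv_pow, one_div]
  gcongr
  linarith

/-- A point of `E'` slightly to the left of `w`, or `w` itself, has a large gap of `E'` to its
left, provided that `E'` is filled by a set having a gap to the left of `w`. -/
theorem exists_gap_near {E' F : Set ℝ} (hE' : IsClosed E') {w g ε δ : ℝ}
    (hw : w ∈ E') (hε : 0 < ε) (hδ : δ + 2 * ε ≤ g)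
    (hgap : Set.Ioo (w - g) w ∩ F = ∅)
    (hfill : ∀ e ∈ E', |e - w| ≤ g → ∃ f ∈ F, |f - e| ≤ ε) :
    ∃ w' ∈ E', w - ε ≤ w' ∧ w' ≤ w ∧ Set.Ioo (w' - δ) w' ∩ E' = ∅ := by
  obtain ⟨w', ⟨hw'E, hw'1, hw'2⟩, hmin⟩ :=
    ((isCompact_Icc (a := w - ε) (b := w)).inter_left hE').exists_isLeast
      ⟨w, hw, by linarith, le_rfl⟩
  refine ⟨w', hw'E, hw'1, hw'2, Set.eq_empty_of_forall_notMem ?_⟩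
  rintro e ⟨⟨he1, he2⟩, heE⟩
  rcases le_or_gt (w - ε) e with h | h
  · have := hmin ⟨heE, h, by linarith⟩
    linarith
  · obtain ⟨f, hfF, hf⟩ := hfill e heE (by rw [abs_le]; constructor <;> linarith)
    rw [abs_le] at hf
    exact Set.eq_empty_iff_forall_notMem.mp hgap f
      ⟨⟨by linarith, by linarith⟩, hfF⟩

/-- A gap on the left of length `1 / nᵏ` is in particular one of length `1 / nˡ`, for `k ≤ l`. -/
theorem gap_mono {n : ℕ} (hn : 2 ≤ n) {E : Set ℝ} {a : ℝ} {k l : ℕ} (hkl : k ≤ l)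
    (h : Set.Ioo (a - 1 / (n : ℝ) ^ k) a ∩ E = ∅) : Set.Ioo (a - 1 / (n : ℝ) ^ l) a ∩ E = ∅ := by
  refine Set.subset_eq_empty (Set.inter_subset_inter_left _ (Set.Ioo_subset_Ioo_left ?_)) h
  have : (1 : ℝ) ≤ n := by exact_mod_cast (by omega : 1 ≤ n)
  gcongr

theorem exists_leftIsolated_map {n : ℕ} (hn : 2 ≤ n) {E E' : Set ℝ} {ρ c z : ℝ} (hρ0 : 0 < ρ)
    (hρ1 : ρ < 1) (hE' : IsClosed E') (hsub : (fun x => ρ * x + c) '' E ⊆ E')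
    (hlat : GapLattice n E) (hlat' : GapLattice n E') (hgap : HasGapsNear n E z)
    (hfill : DenselyFillsAt n ((fun x => ρ * x + c) '' E) E' (ρ * z + c)) :
    ∃ a, LeftIsolated E a ∧ LeftIsolated E' (ρ * a + c) := by
  have hn' : (2 : ℝ) ≤ n := by exact_mod_cast hn
  have hn0 : (0 : ℝ) < n := by linarith
  have hn1 : (1 : ℝ) ≤ n := by linarith
  obtain ⟨D, hD, t, k₀, ht⟩ := hlat
  obtain ⟨D', hD', t', k₀', ht'⟩ := hlat'
  obtain ⟨kz, hkz⟩ := hgap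
  have hDr : (0 : ℝ) < D := by exact_mod_cast hD
  have hDr' : (0 : ℝ) < D' := by exact_mod_cast hD'
  obtain ⟨L₁, hL₁⟩ := exists_one_div_pow_lt hn (δ := ρ / n / 3) (by positivity)
  obtain ⟨κ, hκ, hsep⟩ := exists_int_mul_separation (ρ * D' * n ^ (L₁ + 2) / (D * n ^ 3))
    (2 * D * n ^ 3)
  obtain ⟨L₂, hL₂⟩ := exists_one_div_pow_lt hn (δ := κ / (D' * n ^ (L₁ + 2))) (by positivity)
  set L := max L₁ L₂ with hLdef
  obtain ⟨k₁, hk₁⟩ := hfill L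
  set K := max (max k₀ k₀') (max kz k₁) with hK
  -- the isolated points of `E` near `z`, indexed by scale
  have hstep : ∀ k, ∃ a w' : ℝ, a ∈ E ∧ |a - z| ≤ 1 / (n : ℝ) ^ (K + k) ∧
      Set.Ioo (a - 1 / (n : ℝ) ^ (K + k + 1)) a ∩ E = ∅ ∧ w' ∈ E' ∧
      ρ * a + c - 1 / (n : ℝ) ^ (K + k + L) ≤ w' ∧ w' ≤ ρ * a + c ∧
      Set.Ioo (w' - 1 / (n : ℝ) ^ (K + k + L₁)) w' ∩ E' = ∅ := by
    intro k
    obtain ⟨a, haE, haz, hag⟩ := hkz (K + k) (by omega)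
    have hpk : (0 : ℝ) < 1 / (n : ℝ) ^ (K + k) := by positivity
    have hpow : ∀ j, 1 / (n : ℝ) ^ (K + k + j) = 1 / (n : ℝ) ^ (K + k) * (1 / (n : ℝ) ^ j) := by
      intro j
      rw [pow_add]
      field_simp
    refine ⟨a, (exists_gap_near (F := (fun x => ρ * x + c) '' E) hE'
      (w := ρ * a + c) (g := ρ * (1 / (n : ℝ) ^ (K + k + 1)))
      (ε := 1 / (n : ℝ) ^ (K + k + L)) (δ := 1 / (n : ℝ) ^ (K + k + L₁))
      (hsub ⟨a, haE, rfl⟩) (by positivity) ?_ ?_ ?_).imp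
        fun w' hw' => ⟨haE, haz, hag, hw'⟩⟩
    · have h1 := (hL₁ L₁ le_rfl).le
      have h2 := (hL₁ L (by omega)).le
      rw [hpow, hpow, hpow, pow_one]
      have h3 := mul_le_mul_of_nonneg_left h1 hpk.le
      have h4 := mul_le_mul_of_nonneg_left h2 hpk.le
      have h5 : ρ * (1 / (n : ℝ) ^ (K + k) * (1 / n)) =
        1 / (n : ℝ) ^ (K + k) * (ρ / n / 3) + 2 * (1 / (n : ℝ) ^ (K + k) * (ρ / n / 3)) := by
        ring
      linarith
    · refine Set.eq_empty_of_forall_notMem ?_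
      rintro _ ⟨⟨h1, h2⟩, f, hf, rfl⟩
      refine Set.eq_empty_iff_forall_notMem.mp hag f ⟨⟨?_, ?_⟩, hf⟩
      · refine lt_of_mul_lt_mul_left ?_ hρ0.le
        linarith
      · refine lt_of_mul_lt_mul_left ?_ hρ0.le
        linarith
    · intro e he hew
      refine hk₁ (K + k) (by omega) e he ?_
      have h1 : |(ρ * a + c) - (ρ * z + c)| ≤ 1 / (n : ℝ) ^ (K + k) := by
        rw [show (ρ * a + c) - (ρ * z + c) = ρ * (a - z) by ring, abs_mul, abs_of_pos hρ0]
        nlinarith [abs_nonneg (a - z)]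
      have h2 : ρ * (1 / (n : ℝ) ^ (K + k + 1)) ≤ 1 / (n : ℝ) ^ (K + k) := by
        have : 1 / (n : ℝ) ^ (K + k + 1) ≤ 1 / (n : ℝ) ^ (K + k) :=
          one_div_pow_le_one_div_pow_of_le hn1 (by omega)
        nlinarith [show (0 : ℝ) < 1 / (n : ℝ) ^ (K + k + 1) by positivity]
      have h3 := abs_sub_le e (ρ * a + c) (ρ * z + c)
      have h4 : 2 / (n : ℝ) ^ (K + k) = 1 / (n : ℝ) ^ (K + k) + 1 / (n : ℝ) ^ (K + k) := by ring
      linarith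
  choose a w' haE haz hag hw'E hw'1 hw'2 hw'g using hstep
  have hconst : ∀ k, ρ * a k + c - w' k = ρ * a (k + 1) + c - w' (k + 1) := by
    intro k
    obtain ⟨Z₁, hZ₁⟩ := ht (K + k + 2) (by omega) _ (haE k) (gap_mono hn (by omega) (hag k))
    obtain ⟨Z₂, hZ₂⟩ := ht (K + k + 2) (by omega) _ (haE (k + 1)) (hag (k + 1))
    obtain ⟨Y₁, hY₁⟩ := ht' (K + k + L₁ + 1) (by omega) _ (hw'E k)
      (gap_mono hn (by omega) (hw'g k))
    obtain ⟨Y₂, hY₂⟩ := ht' (K + k + L₁ + 1) (by omega) _ (hw'E (k + 1))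
      (gap_mono hn (by omega) (hw'g (k + 1)))
    have hpk : (0 : ℝ) < (n : ℝ) ^ (K + k) := by positivity
    have hda : a k - a (k + 1) = ((Z₁ - Z₂ : ℤ) : ℝ) / (D * n ^ 3) / (n : ℝ) ^ (K + k) := by
      rw [hZ₁, hZ₂]
      push_cast
      rw [show K + k + 2 + 1 = K + k + 3 by ring, pow_add]
      field_simp
      ring
    have hdw : w' k - w' (k + 1) =
        ((Y₁ - Y₂ : ℤ) : ℝ) / (D' * n ^ (L₁ + 2)) / (n : ℝ) ^ (K + k) := by
      rw [hY₁, hY₂]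
      push_cast
      rw [show K + k + L₁ + 1 + 1 = K + k + (L₁ + 2) by ring, pow_add]
      field_simp
      ring
    have hmono : ∀ j, 1 / (n : ℝ) ^ (K + (k + 1) + j) ≤ 1 / (n : ℝ) ^ (K + k + j) := by
      intro j
      gcongr
      omega
    have hZ : |Z₁ - Z₂| ≤ (2 * D * n ^ 3 : ℕ) := by
      have h1 : |a k - a (k + 1)| ≤ 2 / (n : ℝ) ^ (K + k) := by
        have h2 := abs_sub_le (a k) z (a (k + 1))
        rw [abs_sub_comm z] at h2
        have h3 := haz k
        have h4 := (haz (k + 1)).trans (hmono 0)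
        have h5 : 2 / (n : ℝ) ^ (K + k) = 1 / (n : ℝ) ^ (K + k) + 1 / (n : ℝ) ^ (K + k) := by
          ring
        rw [add_zero] at h4
        linarith
      rw [hda, abs_div, abs_of_pos hpk, div_le_div_iff_of_pos_right hpk, abs_div,
        abs_of_pos (show (0 : ℝ) < D * n ^ 3 by positivity), div_le_iff₀ (by positivity)] at h1
      rw [← Int.cast_abs, ← mul_assoc] at h1
      exact_mod_cast h1
    have hdiff : |(ρ * a k + c - w' k) - (ρ * a (k + 1) + c - w' (k + 1))|
        ≤ 1 / (n : ℝ) ^ (K + k + L) := by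
      have h1 := hw'1 k
      have h2 := hw'1 (k + 1)
      have h3 := hw'2 k
      have h4 := hw'2 (k + 1)
      have h5 := hmono L
      rw [abs_le]
      constructor <;> linarith
    have hrew : (ρ * a k + c - w' k) - (ρ * a (k + 1) + c - w' (k + 1)) =
        (ρ * D' * n ^ (L₁ + 2) / (D * n ^ 3) * ((Z₁ - Z₂ : ℤ) : ℝ) - ((Y₁ - Y₂ : ℤ) : ℝ)) /
          (D' * n ^ (L₁ + 2)) / (n : ℝ) ^ (K + k) := by
      rw [show (ρ * a k + c - w' k) - (ρ * a (k + 1) + c - w' (k + 1)) =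
        ρ * (a k - a (k + 1)) - (w' k - w' (k + 1)) by ring, hda, hdw]
      field_simp
    have hkey := hsep (Z₁ - Z₂) (Y₁ - Y₂) hZ ?_
    · rw [hkey, sub_self, zero_div, zero_div, sub_eq_zero] at hrew
      exact hrew
    · have hL : 1 / (n : ℝ) ^ (K + k + L) = 1 / (n : ℝ) ^ L / (n : ℝ) ^ (K + k) := by
        rw [pow_add]
        field_simp
      rw [hrew, abs_div, abs_of_pos hpk, hL,
        div_le_div_iff_of_pos_right hpk, abs_div,
        abs_of_pos (show (0 : ℝ) < D' * n ^ (L₁ + 2) by positivity)] at hdiff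
      have h1 := hdiff.trans_lt (hL₂ L (by omega))
      rwa [div_lt_div_iff_of_pos_right (by positivity)] at h1
  have hall : ∀ k, ρ * a k + c - w' k = ρ * a 0 + c - w' 0 := by
    intro k
    induction k with
    | zero => rfl
    | succ k ih => rw [← hconst k, ih]
  have hzero : ρ * a 0 + c = w' 0 := by
    refine le_antisymm (le_of_not_gt fun hlt => ?_) (hw'2 0)
    obtain ⟨k, hk⟩ := exists_one_div_pow_lt hn (sub_pos.mpr hlt)
    have h1 := hk (K + k + L) (by omega)
    have h2 := hw'1 k
    have h3 := hall k
    linarith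
  refine ⟨a 0, ⟨haE 0, _, by positivity, hag 0⟩, ?_⟩
  rw [hzero]
  exact ⟨hw'E 0, _, by positivity, hw'g 0⟩

/-- The sequence `S` is constant from some index on. -/
def EventuallyConst (S : ℕ → Finset ℕ) : Prop := ∃ r, ∀ k ≥ r, S k = S r

theorem EventuallyConst.comp {S : ℕ → Finset ℕ} (hS : EventuallyConst S)
    (f : Finset ℕ → Finset ℕ) : EventuallyConst fun k => f (S k) :=
  hS.imp fun _ hr k hk => congrArg f (hr k hk)

/-- The sets that occur as horizontal slices of carpets: a digit set, or a union of two digit sets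
with eventually constant sequences of digits. -/
def IsSliceModel (n : ℕ) (E : Set ℝ) : Prop :=
  (∃ S, ProperDigits n S ∧ E = digitSet n S) ∨
    ∃ S S', ProperDigits n S ∧ ProperDigits n S' ∧ EventuallyConst S ∧ EventuallyConst S' ∧
      E = digitSet n S ∪ digitSet n S'

theorem IsSliceModel.image_one_sub {n : ℕ} {E : Set ℝ} (hE : IsSliceModel n E) :
    IsSliceModel n ((fun x => 1 - x) '' E) := by
  rcases hE with ⟨S, hS, rfl⟩ | ⟨S, S', hS, hS', hc, hc', rfl⟩
  · exact Or.inl ⟨_, hS.reflect, hS.image_one_sub⟩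
  · refine Or.inr ⟨_, _, hS.reflect, hS'.reflect, hc.comp _, hc'.comp _, ?_⟩
    rw [Set.image_union, hS.image_one_sub, hS'.image_one_sub]

theorem IsSliceModel.isCompact {n : ℕ} {E : Set ℝ} (hE : IsSliceModel n E) : IsCompact E := by
  rcases hE with ⟨S, hS, rfl⟩ | ⟨S, S', hS, hS', -, -, rfl⟩
  · exact hS.isCompact
  · exact hS.isCompact.union hS'.isCompact

namespace ProperDigits

variable {n : ℕ} {S : ℕ → Finset ℕ}

theorem eq_of_gap (hS : ProperDigits n S) {E : Set ℝ} (hE : digitSet n S ⊆ E) {e : ℝ} {k : ℕ}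
    (he : e ∈ digitSet n S) (hgap : Set.Ioo (e - 1 / (n : ℝ) ^ k) e ∩ E = ∅) :
    ∃ q : ℕ, e = (q + digitSum n fun l => (S (l + (k + 1))).min' (hS _).1) /
      (n : ℝ) ^ (k + 1) := by
  have hn : (2 : ℝ) ≤ n := by exact_mod_cast hS.two_le
  obtain ⟨d, hd, τ, hτ, rfl⟩ := hS.exists_split he (k + 1)
  have hleast := (hS.tail (k + 1)).isLeast
  have h0 := hS.mem_of_split (fun l _ => hd l) hleast.1
  have h1 := hleast.2 hτ
  have h2 := ((hS.tail (k + 1)).mem_Icc hleast.1).1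
  have h3 := ((hS.tail (k + 1)).mem_Icc hτ).2
  refine ⟨digitPrefix n d (k + 1), ?_⟩
  rcases h1.eq_or_lt with h | h
  · rw [h]
  · refine absurd ⟨⟨?_, ?_⟩, hE h0⟩ (Set.eq_empty_iff_forall_notMem.mp hgap _)
    · have h4 : 1 / (n : ℝ) ^ k = n / (n : ℝ) ^ (k + 1) := by
        rw [pow_succ]
        field_simp
      rw [h4, ← sub_div]
      gcongr
      linarith
    · gcongr

theorem gapLattice (hS : ProperDigits n S) : GapLattice n (digitSet n S) := by
  refine ⟨1, one_pos, fun k => (digitSum n fun l => (S (l + (k + 1))).min' (hS _).1) /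
    (n : ℝ) ^ (k + 1), 0, fun k _ e he hgap => ?_⟩
  obtain ⟨q, hq⟩ := hS.eq_of_gap subset_rfl he hgap
  refine ⟨q, ?_⟩
  rw [hq, add_comm, add_div]
  simp only [Nat.cast_one, one_mul, Int.cast_natCast]

theorem exists_lattice_of_eventuallyConst (hS : ProperDigits n S) (hc : EventuallyConst S) :
    ∃ r, ∀ k ≥ r, ∀ E : Set ℝ, digitSet n S ⊆ E → ∀ e ∈ digitSet n S,
      Set.Ioo (e - 1 / (n : ℝ) ^ k) e ∩ E = ∅ →
        ∃ Z : ℤ, e = Z / ((n - 1 : ℕ) * (n : ℝ) ^ (k + 1)) := by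
  obtain ⟨r, hr⟩ := hc
  refine ⟨r, fun k hk E hE e he hgap => ?_⟩
  obtain ⟨q, rfl⟩ := hS.eq_of_gap hE he hgap
  have hn := hS.two_le
  have hn' : (2 : ℝ) ≤ n := by exact_mod_cast hn
  have hn1 : (n : ℝ) - 1 ≠ 0 := by linarith
  have h1 : (digitSum n fun l => (S (l + (k + 1))).min' (hS _).1) =
      ((S r).min' (hS r).1 : ℝ) / ((n : ℝ) - 1) := by
    have h2 : (fun l => (S (l + (k + 1))).min' (hS _).1) = fun _ => (S r).min' (hS r).1 := by
      funext l
      have := hr (l + (k + 1)) (by omega)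
      simp only [this]
    rw [h2]
    exact (hasSum_const_digit hn _).tsum_eq
  refine ⟨q * (n - 1) + (S r).min' (hS r).1, ?_⟩
  rw [h1, Nat.cast_sub (by omega)]
  push_cast
  field_simp

theorem exists_gap (hS : ProperDigits n S) {z : ℝ} (hz : z ∈ digitSet n S) (k : ℕ) :
    ∃ a ∈ digitSet n S, |a - z| ≤ 1 / (n : ℝ) ^ k ∧
      Set.Ioo (a - 1 / (n : ℝ) ^ (k + 1)) a ∩ digitSet n S = ∅ := by
  have hn : (2 : ℝ) ≤ n := by exact_mod_cast hS.two_le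
  obtain ⟨d, hd, τ, hτ, rfl⟩ := hS.exists_split hz k
  obtain ⟨i, hi, hpred⟩ := hS.exists_no_pred k
  have hleast := (hS.tail (k + 1)).isLeast
  set τ₀ := digitSum n fun l => (S (l + (k + 1))).min' (hS _).1
  set d' : ℕ → ℕ := fun l => if l < k then d l else i with hd'
  have hd'k : d' k = i := by simp [hd']
  have hd'mem : ∀ l < k + 1, d' l ∈ S l := by
    intro l hl
    rcases Nat.lt_succ_iff_lt_or_eq.mp hl with h | rfl
    · simp only [hd', if_pos h]
      exact hd l
    · rwa [hd'k]
  have hp : digitPrefix n d' k = digitPrefix n d k := digitPrefix_congr fun l hl => if_pos hl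
  have hin : (i : ℝ) + 1 ≤ n := by exact_mod_cast hS.lt hi
  have hτ₀ := (hS.tail (k + 1)).mem_Icc hleast.1
  have hτ1 := (hS.tail k).mem_Icc hτ
  refine ⟨_, hS.mem_of_split hd'mem hleast.1, ?_, ?_⟩
  · rw [digitPrefix, hp, hd'k]
    have h1 : ((n * digitPrefix n d k + i : ℕ) + τ₀) / (n : ℝ) ^ (k + 1) -
        (digitPrefix n d k + τ) / (n : ℝ) ^ k = ((i + τ₀) / n - τ) / (n : ℝ) ^ k := by
      rw [pow_succ]
      push_cast
      field_simp
      ring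
    have h2 : (i + τ₀) / n ≤ 1 := by
      rw [div_le_one (by linarith)]
      linarith [hτ₀.2]
    have h3 : 0 ≤ (i + τ₀) / n := div_nonneg (by linarith [hτ₀.1, (Nat.cast_nonneg i : (0 : ℝ) ≤ i)])
      (by linarith)
    rw [h1, abs_div, abs_of_pos (show (0 : ℝ) < (n : ℝ) ^ k by positivity)]
    gcongr
    rw [abs_le]
    constructor <;> linarith [hτ1.1, hτ1.2]
  · refine Set.eq_empty_of_forall_notMem ?_
    rintro e ⟨⟨h1, h2⟩, he⟩
    obtain ⟨f, hf, σ, hσ, rfl⟩ := hS.exists_split he (k + 1)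
    have hσ0 := hleast.2 hσ
    have hσ1 := ((hS.tail (k + 1)).mem_Icc hσ).2
    have hpos : (0 : ℝ) < (n : ℝ) ^ (k + 1) := by positivity
    rw [div_lt_div_iff_of_pos_right hpos] at h2
    rw [← sub_div, div_lt_div_iff_of_pos_right hpos] at h1
    have h3 : (digitPrefix n f (k + 1) : ℝ) < digitPrefix n d' (k + 1) := by linarith
    have h4 : (digitPrefix n d' (k + 1) : ℝ) < digitPrefix n f (k + 1) + 2 := by
      linarith [hτ₀.1]
    have h5 : digitPrefix n f (k + 1) < digitPrefix n d' (k + 1) := by exact_mod_cast h3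
    have h6 : digitPrefix n d' (k + 1) < digitPrefix n f (k + 1) + 2 := by exact_mod_cast h4
    rw [digitPrefix, digitPrefix, hd'k] at h5 h6
    refine hpred (f k) (hf k) (digitPrefix n d' k - digitPrefix n f k) ?_
    rw [mul_sub]
    zify at h5 h6
    linarith

theorem hasGapsNear (hS : ProperDigits n S) {F : Set ℝ} (hF : IsClosed F) {z : ℝ}
    (hz : z ∈ digitSet n S) (hzF : z ∉ F) : HasGapsNear n (digitSet n S ∪ F) z := by
  have hn : (2 : ℝ) ≤ n := by exact_mod_cast hS.two_le
  obtain ⟨r, hr, hball⟩ := Metric.isOpen_iff.mp hF.isOpen_compl z hzF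
  obtain ⟨k₀, hk₀⟩ := exists_one_div_pow_lt hS.two_le (half_pos hr)
  refine ⟨k₀, fun k hk => ?_⟩
  obtain ⟨a, ha, haz, hgap⟩ := hS.exists_gap hz k
  refine ⟨a, Or.inl ha, haz, ?_⟩
  rw [Set.inter_union_distrib_left, hgap, Set.empty_union]
  refine Set.eq_empty_of_forall_notMem ?_
  rintro e ⟨⟨h1, h2⟩, he⟩
  refine hball (Metric.mem_ball.mpr ?_) he
  have h3 := hk₀ k hk
  have h4 : 1 / (n : ℝ) ^ (k + 1) ≤ 1 / (n : ℝ) ^ k :=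
    one_div_pow_le_one_div_pow_of_le (by linarith) (by omega)
  rw [abs_le] at haz
  rw [Real.dist_eq, abs_lt]
  constructor <;> linarith

end ProperDigits

theorem IsSliceModel.gapLattice {n : ℕ} {E : Set ℝ} (hE : IsSliceModel n E) :
    GapLattice n E := by
  rcases hE with ⟨S, hS, rfl⟩ | ⟨S, S', hS, hS', hc, hc', rfl⟩
  · exact hS.gapLattice
  · obtain ⟨r, hr⟩ := hS.exists_lattice_of_eventuallyConst hc
    obtain ⟨r', hr'⟩ := hS'.exists_lattice_of_eventuallyConst hc'
    have := hS.two_le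
    refine ⟨n - 1, by omega, fun _ => 0, max r r', fun k hk e he hgap => ?_⟩
    simp only [zero_add]
    rcases he with he | he
    · exact hr k (by omega) _ Set.subset_union_left e he hgap
    · exact hr' k (by omega) _ Set.subset_union_right e he hgap

open scoped ENNReal Pointwise

/-- At small scales around `x`, the balls of `μ` centred at points of `E` are not much lighter
than those of comparable radius centred at `x`. -/
def DoublingAt (n : ℕ) (μ : Measure ℝ) (E : Set ℝ) (x : ℝ) : Prop :=
  ∀ L : ℕ, ∃ C : ℝ≥0∞, C ≠ ⊤ ∧ ∃ k₀ : ℕ, ∀ k ≥ k₀, ∀ e ∈ E, |e - x| ≤ 2 / (n : ℝ) ^ k →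
    μ (Metric.closedBall x (3 / (n : ℝ) ^ k)) ≤
      C * μ (Metric.closedBall e (1 / (n : ℝ) ^ (k + L)))

theorem hausdorffMeasure_image_affine {α : ℝ} (hα : 0 ≤ α) {r : ℝ} (hr : r ≠ 0) (c : ℝ) :
    ∃ lam : ℝ≥0∞, lam ≠ 0 ∧ ∀ A : Set ℝ, μH[α] ((fun x => r * x + c) '' A) = lam * μH[α] A := by
  refine ⟨(‖r‖₊ ^ α : NNReal), ?_, fun A => ?_⟩
  · rw [ENNReal.coe_ne_zero]
    exact (NNReal.rpow_pos (nnnorm_pos.mpr hr)).ne'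
  · have h1 : (fun x => r * x + c) '' A = (fun x => x + c) '' (r • A) := by
      rw [← Set.image_smul, Set.image_image]
      rfl
    have h2 : Isometry fun x : ℝ => x + c := (IsometryEquiv.addRight c).isometry
    rw [h1, h2.hausdorffMeasure_image (Or.inl hα), Measure.hausdorffMeasure_smul₀ hα hr]
    rfl

/-- The Hausdorff measure of a cylinder of level `k` of `digitSet n S`. -/
noncomputable def cylinderMeasure (α : ℝ) (n : ℕ) (S : ℕ → Finset ℕ) (k : ℕ) : ℝ≥0∞ :=
  μH[α] ((fun τ : ℝ => τ / (n : ℝ) ^ k) '' digitSet n fun l => S (l + k))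

theorem hausdorffMeasure_cylinder {α : ℝ} (hα : 0 ≤ α) (n : ℕ) (S : ℕ → Finset ℕ) (k : ℕ)
    (q : ℝ) : μH[α] ((fun τ : ℝ => (q + τ) / (n : ℝ) ^ k) '' digitSet n fun l => S (l + k)) =
      cylinderMeasure α n S k := by
  have h1 : Isometry fun x : ℝ => x + q / (n : ℝ) ^ k :=
    (IsometryEquiv.addRight (q / (n : ℝ) ^ k)).isometry
  rw [cylinderMeasure, ← h1.hausdorffMeasure_image (Or.inl hα)
    ((fun τ : ℝ => τ / (n : ℝ) ^ k) '' digitSet n fun l => S (l + k)), Set.image_image]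
  congr 2
  funext τ
  ring

namespace ProperDigits

variable {n : ℕ} {S S' : ℕ → Finset ℕ} {α : ℝ}

theorem measure_inter_closedBall_le (hS : ProperDigits n S) (hα : 0 ≤ α) (x : ℝ) (k : ℕ) :
    μH[α] (digitSet n S ∩ Metric.closedBall x (3 / (n : ℝ) ^ k)) ≤
      9 * cylinderMeasure α n S k := by
  have hn : (2 : ℝ) ≤ n := by exact_mod_cast hS.two_le
  have hpos : (0 : ℝ) < (n : ℝ) ^ k := by positivity
  have hcover : digitSet n S ∩ Metric.closedBall x (3 / (n : ℝ) ^ k) ⊆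
      ⋃ q ∈ Finset.Icc (-4 : ℤ) 4, (fun τ : ℝ => (((⌊x * (n : ℝ) ^ k⌋ + q : ℤ) : ℝ) + τ) /
        (n : ℝ) ^ k) '' digitSet n fun l => S (l + k) := by
    rintro e ⟨he, hex⟩
    obtain ⟨d, -, τ, hτ, rfl⟩ := hS.exists_split he k
    have hτ1 := (hS.tail k).mem_Icc hτ
    rw [Metric.mem_closedBall, Real.dist_eq] at hex
    have h1 : (digitPrefix n d k + τ) / (n : ℝ) ^ k - x =
        (digitPrefix n d k + τ - x * (n : ℝ) ^ k) / (n : ℝ) ^ k := by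
      field_simp
    rw [h1, abs_div, abs_of_pos hpos, div_le_div_iff_of_pos_right hpos, abs_le] at hex
    have h2 := Int.floor_le (x * (n : ℝ) ^ k)
    have h3 := Int.lt_floor_add_one (x * (n : ℝ) ^ k)
    set u := ⌊x * (n : ℝ) ^ k⌋
    refine Set.mem_biUnion (x := (digitPrefix n d k : ℤ) - u) ?_ ⟨τ, hτ, ?_⟩
    · have h4 : ((u - 4 : ℤ) : ℝ) ≤ (digitPrefix n d k : ℤ) := by
        push_cast
        linarith [hτ1.2]
      have h5 : ((digitPrefix n d k : ℤ) : ℝ) ≤ (u + 4 : ℤ) := by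
        push_cast
        linarith [hτ1.1]
      have h6 := Int.cast_le.mp h4
      have h7 := Int.cast_le.mp h5
      simp only [Finset.coe_Icc, Set.mem_Icc]
      omega
    · simp
  refine (measure_mono hcover).trans ((measure_biUnion_finset_le _ _).trans ?_)
  simp only [hausdorffMeasure_cylinder hα, Finset.sum_const]
  simp

theorem cylinderMeasure_le (hS : ProperDigits n S) (hα : 0 ≤ α) {e : ℝ} (he : e ∈ digitSet n S)
    (k : ℕ) : cylinderMeasure α n S k ≤
      μH[α] (digitSet n S ∩ Metric.closedBall e (1 / (n : ℝ) ^ k)) := by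
  have hn : (2 : ℝ) ≤ n := by exact_mod_cast hS.two_le
  have hpos : (0 : ℝ) < (n : ℝ) ^ k := by positivity
  obtain ⟨d, hd, τ, hτ, rfl⟩ := hS.exists_split he k
  rw [← hausdorffMeasure_cylinder hα n S k (digitPrefix n d k)]
  refine measure_mono ?_
  rintro _ ⟨σ, hσ, rfl⟩
  refine ⟨hS.mem_of_split (fun l _ => hd l) hσ, ?_⟩
  have h1 := (hS.tail k).mem_Icc hτ
  have h2 := (hS.tail k).mem_Icc hσ
  rw [Metric.mem_closedBall, Real.dist_eq, ← sub_div, abs_div, abs_of_pos hpos]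
  gcongr
  rw [abs_le]
  constructor <;> linarith [h1.1, h1.2, h2.1, h2.2]

theorem cylinderMeasure_le_mul_succ (hS : ProperDigits n S) (hα : 0 ≤ α) (k : ℕ) :
    cylinderMeasure α n S k ≤ n * cylinderMeasure α n S (k + 1) := by
  have hcover : (fun τ : ℝ => τ / (n : ℝ) ^ k) '' (digitSet n fun l => S (l + k)) ⊆
      ⋃ i ∈ Finset.range n, (fun τ : ℝ => ((i : ℝ) + τ) / (n : ℝ) ^ (k + 1)) ''
        digitSet n fun l => S (l + (k + 1)) := by
    rintro _ ⟨τ, hτ, rfl⟩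
    obtain ⟨d, hd, σ, hσ, rfl⟩ := (hS.tail k).exists_split hτ 1
    refine Set.mem_biUnion (x := d 0) ?_ ⟨σ, ?_, ?_⟩
    · exact Finset.mem_coe.mpr (Finset.mem_range.mpr ((hS.tail k).lt (hd 0)))
    · simpa only [add_assoc, add_comm 1 k] using hσ
    · simp only [digitPrefix, mul_zero, zero_add, pow_one]
      rw [div_div, pow_succ']
  refine (measure_mono hcover).trans ((measure_biUnion_finset_le _ _).trans ?_)
  simp only [hausdorffMeasure_cylinder hα, Finset.sum_const]
  simp

theorem cylinderMeasure_le_pow_mul (hS : ProperDigits n S) (hα : 0 ≤ α) (k L : ℕ) :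
    cylinderMeasure α n S k ≤ (n : ℝ≥0∞) ^ L * cylinderMeasure α n S (k + L) := by
  induction L with
  | zero => simp
  | succ L ih =>
    calc _ ≤ _ := ih
      _ ≤ (n : ℝ≥0∞) ^ L * (n * cylinderMeasure α n S (k + L + 1)) := by
        gcongr
        exact hS.cylinderMeasure_le_mul_succ hα _
      _ = _ := by rw [pow_succ, mul_assoc, add_assoc]

theorem measure_eq_zero_of_cylinderMeasure (hS : ProperDigits n S) (hα : 0 ≤ α) {k : ℕ}
    (h : cylinderMeasure α n S k = 0) : μH[α] (digitSet n S) = 0 := by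
  have h1 := hS.cylinderMeasure_le_pow_mul hα 0 k
  rw [zero_add, h, mul_zero, nonpos_iff_eq_zero, cylinderMeasure] at h1
  simpa using h1

theorem cylinderMeasure_le_measure (hS : ProperDigits n S) (hα : 0 ≤ α) (k : ℕ) :
    cylinderMeasure α n S k ≤ μH[α] (digitSet n S) := by
  obtain ⟨e, he⟩ : (digitSet n S).Nonempty := ⟨_, hS.isLeast.1⟩
  exact (hS.cylinderMeasure_le hα he k).trans (measure_mono Set.inter_subset_left)

theorem measure_eq_zero_of_diff (hS : ProperDigits n S) (hα : 0 ≤ α) {F : Set ℝ}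
    (hF : IsClosed F) (hne : (digitSet n S \ F).Nonempty) (h0 : μH[α] (digitSet n S \ F) = 0) :
    μH[α] (digitSet n S) = 0 := by
  obtain ⟨z, hz, hzF⟩ := hne
  obtain ⟨r, hr, hball⟩ := Metric.isOpen_iff.mp hF.isOpen_compl z hzF
  obtain ⟨k, hk⟩ := exists_one_div_pow_lt hS.two_le hr
  refine hS.measure_eq_zero_of_cylinderMeasure hα (k := k) ?_
  refine le_antisymm ((hS.cylinderMeasure_le hα hz k).trans ?_) zero_le
  rw [← h0]
  refine measure_mono fun e he => ⟨he.1, hball ?_⟩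
  exact Metric.closedBall_subset_ball (hk k le_rfl) he.2

end ProperDigits

theorem exists_cylinderMeasure_scaling {n : ℕ} {α : ℝ} (hn : 2 ≤ n) (hα : 0 ≤ α) :
    ∃ lam : ℝ≥0∞, ∀ S, EventuallyConst S → ∃ r, ∀ R ≥ r, ∀ j,
      cylinderMeasure α n S (R + j) = lam ^ j * cylinderMeasure α n S R := by
  obtain ⟨lam, -, hlam⟩ :=
    hausdorffMeasure_image_affine hα (r := (n : ℝ)⁻¹) (by positivity) 0
  refine ⟨lam, fun S ⟨r, hr⟩ => ⟨r, fun R hR j => ?_⟩⟩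
  induction j with
  | zero => simp
  | succ j ih =>
    rw [pow_succ', mul_assoc, ← ih, cylinderMeasure, cylinderMeasure, ← hlam, Set.image_image]
    have h1 : (fun l => S (l + (R + (j + 1)))) = fun l => S (l + (R + j)) := by
      funext l
      rw [hr (l + (R + (j + 1))) (by omega), hr (l + (R + j)) (by omega)]
    rw [h1]
    congr 2
    funext τ
    rw [← add_assoc, pow_succ]
    field_simp
    simp

theorem exists_cylinderMeasure_le_mul {n : ℕ} {S S' : ℕ → Finset ℕ} {α : ℝ}
    (hS : ProperDigits n S) (hS' : ProperDigits n S') (hα : 0 ≤ α) (hc : EventuallyConst S)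
    (hc' : EventuallyConst S') (hfin : μH[α] (digitSet n S) ≠ ⊤)
    (hpos : μH[α] (digitSet n S') ≠ 0) (hfin' : μH[α] (digitSet n S') ≠ ⊤) :
    ∃ A : ℝ≥0∞, A ≠ ⊤ ∧ ∃ r, ∀ k ≥ r,
      cylinderMeasure α n S k ≤ A * cylinderMeasure α n S' k := by
  obtain ⟨lam, hlam⟩ := exists_cylinderMeasure_scaling hS.two_le hα
  obtain ⟨r, hr⟩ := hlam S hc
  obtain ⟨r', hr'⟩ := hlam S' hc'
  set R := max r r'
  have h0 : cylinderMeasure α n S' R ≠ 0 := fun h =>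
    hpos (hS'.measure_eq_zero_of_cylinderMeasure hα h)
  have htop : cylinderMeasure α n S R ≠ ⊤ :=
    ne_top_of_le_ne_top hfin (hS.cylinderMeasure_le_measure hα R)
  have htop' : cylinderMeasure α n S' R ≠ ⊤ :=
    ne_top_of_le_ne_top hfin' (hS'.cylinderMeasure_le_measure hα R)
  refine ⟨cylinderMeasure α n S R / cylinderMeasure α n S' R, ENNReal.div_ne_top htop h0, R,
    fun k hk => ?_⟩
  obtain ⟨j, rfl⟩ := Nat.exists_eq_add_of_le hk
  rw [hr R (le_max_left _ _), hr' R (le_max_right _ _), mul_left_comm,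
    ENNReal.div_mul_cancel h0 htop']

theorem ProperDigits.measure_closedBall_le {n : ℕ} {S : ℕ → Finset ℕ} {α : ℝ}
    (hS : ProperDigits n S) (hα : 0 ≤ α) (x : ℝ) {e : ℝ} (he : e ∈ digitSet n S) (k L : ℕ) :
    μH[α] (digitSet n S ∩ Metric.closedBall x (3 / (n : ℝ) ^ k)) ≤
      9 * (n : ℝ≥0∞) ^ L * μH[α] (digitSet n S ∩ Metric.closedBall e (1 / (n : ℝ) ^ (k + L))) := by
  refine (hS.measure_inter_closedBall_le hα x k).trans ?_
  rw [mul_assoc]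
  gcongr
  refine (hS.cylinderMeasure_le_pow_mul hα k L).trans ?_
  gcongr
  exact hS.cylinderMeasure_le hα he _

theorem ProperDigits.doublingAt_of_notMem {n : ℕ} {S : ℕ → Finset ℕ} {α : ℝ}
    (hS : ProperDigits n S) (hα : 0 ≤ α) {F : Set ℝ} (hF : IsClosed F) {x : ℝ} (hx : x ∉ F) :
    DoublingAt n (μH[α].restrict (digitSet n S ∪ F)) (digitSet n S ∪ F) x := by
  have hn := hS.two_le
  obtain ⟨r, hr, hball⟩ := Metric.isOpen_iff.mp hF.isOpen_compl x hx
  obtain ⟨k₀, hk₀⟩ := exists_one_div_pow_lt hn (show 0 < r / 3 by positivity)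
  refine fun L => ⟨9 * (n : ℝ≥0∞) ^ L, ENNReal.mul_ne_top (by simp) (by simp), k₀,
    fun k hk e he hex => ?_⟩
  have hpos : (0 : ℝ) < (n : ℝ) ^ k := by positivity
  have h3 : 3 / (n : ℝ) ^ k < r := by
    have h4 := hk₀ k hk
    rw [show 3 / (n : ℝ) ^ k = 3 * (1 / (n : ℝ) ^ k) by ring]
    linarith
  have hnot : ∀ f ∈ F, f ∉ Metric.closedBall x (3 / (n : ℝ) ^ k) := fun f hf hfx =>
    hball (Metric.closedBall_subset_ball h3 hfx) hf
  have heS : e ∈ digitSet n S := by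
    refine he.resolve_right fun heF => hnot e heF ?_
    rw [Metric.mem_closedBall, Real.dist_eq]
    exact hex.trans (by gcongr; norm_num)
  rw [Measure.restrict_apply measurableSet_closedBall,
    Measure.restrict_apply measurableSet_closedBall]
  refine (measure_mono ?_).trans ((hS.measure_closedBall_le hα x heS k L).trans ?_)
  · rintro f ⟨hf, hfS | hfF⟩
    · exact ⟨hfS, hf⟩
    · exact absurd hf (hnot f hfF)
  · refine mul_le_mul_right (measure_mono ?_) _
    exact fun f hf => ⟨hf.2, Or.inl hf.1⟩

theorem ProperDigits.doublingAt_union {n : ℕ} {S S' : ℕ → Finset ℕ} {α : ℝ}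
    (hS : ProperDigits n S) (hS' : ProperDigits n S') (hα : 0 ≤ α) (hc : EventuallyConst S)
    (hc' : EventuallyConst S') (hpos : μH[α] (digitSet n S) ≠ 0)
    (hfin : μH[α] (digitSet n S) ≠ ⊤) (hpos' : μH[α] (digitSet n S') ≠ 0)
    (hfin' : μH[α] (digitSet n S') ≠ ⊤) (x : ℝ) :
    DoublingAt n (μH[α].restrict (digitSet n S ∪ digitSet n S'))
      (digitSet n S ∪ digitSet n S') x := by
  obtain ⟨A, hA, r, hr⟩ := exists_cylinderMeasure_le_mul hS hS' hα hc hc' hfin hpos' hfin'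
  obtain ⟨A', hA', r', hr'⟩ := exists_cylinderMeasure_le_mul hS' hS hα hc' hc hfin' hpos hfin
  refine fun L => ⟨9 * (1 + A + A') * (n : ℝ≥0∞) ^ L, by finiteness, max r r',
    fun k hk e he hex => ?_⟩
  have hball : ∀ (T : ℕ → Finset ℕ), ProperDigits n T → e ∈ digitSet n T →
      digitSet n T ⊆ digitSet n S ∪ digitSet n S' →
      (n : ℝ≥0∞) ^ L * μH[α] (Metric.closedBall e (1 / (n : ℝ) ^ (k + L)) ∩
        (digitSet n S ∪ digitSet n S')) ≥ cylinderMeasure α n T k := by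
    intro T hT heT hsub
    refine (hT.cylinderMeasure_le_pow_mul hα k L).trans ?_
    gcongr
    refine (hT.cylinderMeasure_le hα heT _).trans (measure_mono ?_)
    exact fun f hf => ⟨hf.2, hsub hf.1⟩
  rw [Measure.restrict_apply measurableSet_closedBall,
    Measure.restrict_apply measurableSet_closedBall, Set.inter_union_distrib_left,
    Set.inter_comm _ (digitSet n S), Set.inter_comm _ (digitSet n S')]
  refine (measure_union_le _ _).trans ?_
  have h1 := add_le_add (hS.measure_inter_closedBall_le hα x k)
    (hS'.measure_inter_closedBall_le hα x k)
  refine h1.trans ?_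
  rw [mul_assoc, mul_assoc, ← mul_add]
  gcongr
  rcases he with he | he
  · refine le_trans ?_ (mul_le_mul_right (hball S hS he Set.subset_union_left) _)
    rw [add_mul, add_mul, one_mul]
    gcongr ?_ + ?_
    · exact le_self_add
    · exact hr' k (by omega)
  · refine le_trans ?_ (mul_le_mul_right (hball S' hS' he Set.subset_union_right) _)
    rw [add_mul, add_mul, one_mul, add_comm (cylinderMeasure α n S k)]
    refine le_trans ?_ le_self_add
    gcongr
    exact hr k (by omega)

theorem IsSliceModel.ae_doublingAt {n : ℕ} {E : Set ℝ} {α : ℝ} (hE : IsSliceModel n E)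
    (hα : 0 ≤ α) (hfin : μH[α] E < ⊤) :
    ∀ᵐ x ∂(μH[α].restrict E), DoublingAt n (μH[α].restrict E) E x := by
  rcases hE with ⟨S, hS, rfl⟩ | ⟨S, S', hS, hS', hc, hc', rfl⟩
  · refine Filter.Eventually.of_forall fun x => ?_
    have h1 := hS.doublingAt_of_notMem hα isClosed_empty (Set.notMem_empty x)
    rwa [Set.union_empty] at h1
  · by_cases h0 : μH[α] (digitSet n S) = 0
    · filter_upwards [ae_restrict_of_ae (measure_eq_zero_iff_ae_notMem.mp h0)] with x hx
      rw [Set.union_comm]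
      exact hS'.doublingAt_of_notMem hα hS.isCompact.isClosed hx
    by_cases h0' : μH[α] (digitSet n S') = 0
    · filter_upwards [ae_restrict_of_ae (measure_eq_zero_iff_ae_notMem.mp h0')] with x hx
      exact hS.doublingAt_of_notMem hα hS'.isCompact.isClosed hx
    refine Filter.Eventually.of_forall fun x => hS.doublingAt_union hS' hα hc hc' h0 ?_ h0' ?_ x
    · exact ((measure_mono Set.subset_union_left).trans_lt hfin).ne
    · exact ((measure_mono Set.subset_union_right).trans_lt hfin).ne

theorem IsSliceModel.exists_hasGapsNear {n : ℕ} {E : Set ℝ} {α : ℝ} (hE : IsSliceModel n E)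
    (hα : 0 ≤ α) (hpos : 0 < μH[α] E) :
    ∃ Z ⊆ E, 0 < μH[α] Z ∧ ∀ z ∈ Z, HasGapsNear n E z := by
  have hsingle : ∀ {S}, ProperDigits n S → 0 < μH[α] (digitSet n S) →
      ∃ Z ⊆ digitSet n S, 0 < μH[α] Z ∧ ∀ z ∈ Z, HasGapsNear n (digitSet n S) z := by
    intro S hS h
    refine ⟨_, subset_rfl, h, fun z hz => ?_⟩
    have h1 := hS.hasGapsNear isClosed_empty hz (Set.notMem_empty z)
    rwa [Set.union_empty] at h1
  rcases hE with ⟨S, hS, rfl⟩ | ⟨S, S', hS, hS', -, -, rfl⟩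
  · exact hsingle hS hpos
  · have hF := hS.isCompact.isClosed
    have hF' := hS'.isCompact.isClosed
    by_cases h1 : μH[α] (digitSet n S \ digitSet n S') = 0
    · by_cases h2 : μH[α] (digitSet n S' \ digitSet n S) = 0
      · by_cases h3 : digitSet n S ⊆ digitSet n S'
        · rw [Set.union_eq_self_of_subset_left h3] at hpos ⊢
          exact hsingle hS' hpos
        by_cases h4 : digitSet n S' ⊆ digitSet n S
        · rw [Set.union_eq_self_of_subset_right h4] at hpos ⊢
          exact hsingle hS hpos
        refine absurd ?_ hpos.ne'
        rw [measure_union_null_iff]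
        exact ⟨hS.measure_eq_zero_of_diff hα hF' (Set.sdiff_nonempty.mpr h3) h1,
          hS'.measure_eq_zero_of_diff hα hF (Set.sdiff_nonempty.mpr h4) h2⟩
      · refine ⟨_, Set.sdiff_subset.trans Set.subset_union_right, pos_iff_ne_zero.mpr h2,
          fun z hz => ?_⟩
        rw [Set.union_comm]
        exact hS'.hasGapsNear hF hz.1 hz.2
    · exact ⟨_, Set.sdiff_subset.trans Set.subset_union_left, pos_iff_ne_zero.mpr h1,
        fun z hz => hS.hasGapsNear hF' hz.1 hz.2⟩

/-- If `μ`-almost all of the mass of `E` near `x` lies in `s`, then `s` fills `E` near `x`. -/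
theorem DoublingAt.denselyFillsAt {n : ℕ} {μ : Measure ℝ} [IsFiniteMeasure μ] {s E : Set ℝ}
    {x : ℝ} (hn : 2 ≤ n) (hx : DoublingAt n μ E x)
    (hlim : Filter.Tendsto
      (fun r => μ (s ∩ Metric.closedBall x r) / μ (Metric.closedBall x r))
      (nhdsWithin 0 (Set.Ioi 0)) (nhds 1)) : DenselyFillsAt n s E x := by
  intro L
  obtain ⟨C, hC, k₀, hk₀⟩ := hx L
  have hn' : (2 : ℝ) ≤ n := by exact_mod_cast hn
  have hlt : 1 - (2 * (C + 1))⁻¹ < 1 := by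
    refine ENNReal.sub_lt_self (by simp) one_ne_zero ?_
    exact ENNReal.inv_ne_zero.mpr (by finiteness)
  have hev := hlim.eventually (lt_mem_nhds hlt)
  obtain ⟨δ, hδ, hball⟩ := Metric.mem_nhdsWithin_iff.mp hev
  obtain ⟨k₂, hk₂⟩ := exists_one_div_pow_lt hn (show 0 < δ / 3 by positivity)
  refine ⟨max k₀ k₂, fun k hk e he hex => ?_⟩
  by_contra! hcon
  have hpos : (0 : ℝ) < (n : ℝ) ^ k := by positivity
  set B := Metric.closedBall x (3 / (n : ℝ) ^ k) with hB
  set B' := Metric.closedBall e (1 / (n : ℝ) ^ (k + L)) with hB'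
  have hdoub : μ B ≤ C * μ B' := hk₀ k (by omega) e he hex
  have hratio : 1 - (2 * (C + 1))⁻¹ < μ (s ∩ B) / μ B := by
    refine hball ⟨?_, Set.mem_Ioi.mpr (by positivity)⟩
    have h4 := hk₂ k (by omega)
    rw [Metric.mem_ball, Real.dist_eq, sub_zero, abs_of_pos (by positivity),
      show 3 / (n : ℝ) ^ k = 3 * (1 / (n : ℝ) ^ k) by ring]
    linarith
  have hdisj : Disjoint (s ∩ B) B' := by
    rw [Set.disjoint_left]
    intro f hf hfe
    rw [hB', Metric.mem_closedBall, Real.dist_eq] at hfe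
    exact absurd hfe (not_le.mpr (hcon f hf.1))
  have hsubB : B' ⊆ B := by
    refine Metric.closedBall_subset_closedBall' ?_
    have h1 : 1 / (n : ℝ) ^ (k + L) ≤ 1 / (n : ℝ) ^ k :=
      one_div_pow_le_one_div_pow_of_le (by linarith) (by omega)
    rw [Real.dist_eq, show 3 / (n : ℝ) ^ k = 1 / (n : ℝ) ^ k + 2 / (n : ℝ) ^ k by ring]
    linarith
  have hsum : μ (s ∩ B) + μ B' ≤ μ B := by
    rw [← measure_union hdisj measurableSet_closedBall]
    exact measure_mono (Set.union_subset Set.inter_subset_right hsubB)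
  have hB0 : μ B ≠ 0 := by
    intro h0
    have h1 : μ (s ∩ B) = 0 := measure_mono_null Set.inter_subset_right h0
    rw [h1, ENNReal.zero_div] at hratio
    exact not_lt_zero hratio
  lift C to NNReal using hC
  have hr : (1 - (2 * ((C : ℝ) + 1))⁻¹) * μ.real B < μ.real (s ∩ B) := by
    have h1 := ENNReal.toReal_strict_mono
      (ENNReal.div_ne_top (measure_ne_top μ _) hB0) hratio
    rw [ENNReal.toReal_sub_of_le (ENNReal.inv_le_one.mpr ?_) ENNReal.one_ne_top,
      ENNReal.toReal_div, lt_div_iff₀ (ENNReal.toReal_pos hB0 (by finiteness))] at h1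
    · simpa [Measure.real, ENNReal.toReal_add] using h1
    · norm_cast
      have : (0 : NNReal) ≤ C := zero_le
      linarith
  have hd : μ.real B ≤ C * μ.real B' := by
    have := ENNReal.toReal_mono (by finiteness) hdoub
    simpa [Measure.real] using this
  have hsm : μ.real (s ∩ B) + μ.real B' ≤ μ.real B := by
    have := ENNReal.toReal_mono (by finiteness) hsum
    rwa [ENNReal.toReal_add (by finiteness) (by finiteness)] at this
  have h0 : 0 < μ.real B := ENNReal.toReal_pos hB0 (by finiteness)
  have hc0 : (0 : ℝ) ≤ C := C.2
  have h5 : (2 * ((C : ℝ) + 1))⁻¹ * μ.real B > μ.real B' := by linarith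
  rw [gt_iff_lt, inv_mul_eq_div, lt_div_iff₀ (by positivity)] at h5
  nlinarith [measureReal_nonneg (μ := μ) (s := B')]

theorem IsSliceModel.exists_leftIsolated_map {n : ℕ} {E E' : Set ℝ} {α ρ c : ℝ} (hn : 2 ≤ n)
    (hE : IsSliceModel n E) (hE' : IsSliceModel n E') (hα : 0 ≤ α) (hpos : 0 < μH[α] E)
    (hfin : μH[α] E' < ⊤) (hρ0 : 0 < ρ) (hρ1 : ρ < 1)
    (hsub : (fun x => ρ * x + c) '' E ⊆ E') :
    ∃ a, LeftIsolated E a ∧ LeftIsolated E' (ρ * a + c) := by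
  obtain ⟨Z, hZE, hZ, hgap⟩ := hE.exists_hasGapsNear hα hpos
  obtain ⟨lam, hlam0, hlam⟩ := hausdorffMeasure_image_affine hα hρ0.ne' c
  set g : ℝ → ℝ := fun x => ρ * x + c with hg
  have hs : MeasurableSet (g '' E) := (hE.isCompact.image (by fun_prop)).measurableSet
  set μ := (μH[α] : Measure ℝ).restrict E'
  have : IsFiniteMeasure μ := ⟨by rwa [Measure.restrict_apply_univ]⟩
  have hae : ∀ᵐ x ∂μ.restrict (g '' E), DenselyFillsAt n (g '' E) E' x := by
    filter_upwards [Besicovitch.ae_tendsto_measure_inter_div μ (g '' E),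
      ae_restrict_of_ae (hE'.ae_doublingAt hα hfin)] with x hx hx'
    exact hx'.denselyFillsAt hn hx
  rw [Measure.restrict_restrict_of_subset hsub, ae_restrict_iff'₀ hs.nullMeasurableSet] at hae
  have hne : ∃ x ∈ g '' Z, DenselyFillsAt n (g '' E) E' x := by
    by_contra! hcon
    refine mul_ne_zero hlam0 hZ.ne' ?_
    rw [← hlam]
    refine measure_mono_null (fun x hx => ?_) (ae_iff.mp hae)
    exact fun hx' => hcon x hx (hx' (Set.image_mono hZE hx))
  obtain ⟨_, ⟨z, hz, rfl⟩, hfill⟩ := hne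
  exact _root_.exists_leftIsolated_map hn hρ0 hρ1 hE'.isCompact.isClosed hsub hE.gapLattice
    hE'.gapLattice (hgap z hz) hfill

theorem rightIsolated_of_leftIsolated_image {E : Set ℝ} {b : ℝ}
    (h : LeftIsolated ((fun x => 1 - x) '' E) (1 - b)) : RightIsolated E b := by
  obtain ⟨⟨b', hb', hbb⟩, r, hr, hgap⟩ := h
  obtain rfl : b' = b := by simpa using hbb
  refine ⟨hb', r, hr, Set.eq_empty_of_forall_notMem ?_⟩
  rintro e ⟨⟨h1, h2⟩, he⟩
  exact Set.eq_empty_iff_forall_notMem.mp hgap (1 - e)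
    ⟨⟨by linarith, by linarith⟩, e, he, rfl⟩

theorem hausdorffMeasure_image_one_sub {α : ℝ} (hα : 0 ≤ α) (E : Set ℝ) :
    μH[α] ((fun x : ℝ => 1 - x) '' E) = μH[α] E :=
  (show Isometry fun x : ℝ => 1 - x from
    Isometry.of_dist_eq fun x y => dist_sub_left 1 x y).hausdorffMeasure_image (Or.inl hα) E

theorem IsSliceModel.exists_isolated_map {n : ℕ} {E : Set ℝ} {α ρ : ℝ} {h : ℝ → ℝ} (hn : 2 ≤ n)
    (hE : IsSliceModel n E) (hne : E.Nonempty) (hα : 0 ≤ α) (hpos : 0 < μH[α] E)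
    (hfin : μH[α] E < ⊤) (hρ0 : 0 < ρ) (hρ1 : ρ < 1) (hsub : h '' E ⊆ E) :
    ∃ a b : ℝ, LeftIsolated E a ∧ RightIsolated E b ∧
      ((∃ c : ℝ, ∀ x, h x = ρ * x + c) → LeftIsolated E (h a) ∧ RightIsolated E (h b)) ∧
      ((∃ c : ℝ, ∀ x, h x = -ρ * x + c) → LeftIsolated E (h b) ∧ RightIsolated E (h a)) := by
  have hR := hE.image_one_sub
  have hposR := (hausdorffMeasure_image_one_sub hα E).symm ▸ hpos
  have hfinR := (hausdorffMeasure_image_one_sub hα E).symm ▸ hfin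
  have hmem : ∀ x ∈ E, h x ∈ E := fun x hx => hsub ⟨x, hx, rfl⟩
  by_cases h1 : ∃ c : ℝ, ∀ x, h x = ρ * x + c
  · have h2 : ¬∃ c : ℝ, ∀ x, h x = -ρ * x + c := by
      rintro ⟨c', hc'⟩
      obtain ⟨c, hc⟩ := h1
      have e0 := hc 0
      have e1 := hc 1
      rw [hc'] at e0 e1
      linarith
    obtain ⟨c, hc⟩ := h1
    obtain ⟨a, ha, ha'⟩ := hE.exists_leftIsolated_map hn hE hα hpos hfin hρ0 hρ1 (c := c) <| by
      rintro _ ⟨x, hx, rfl⟩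
      simpa only [← hc] using hmem x hx
    obtain ⟨b, hb, hb'⟩ := hR.exists_leftIsolated_map hn hR hα hposR hfinR hρ0 hρ1
        (c := 1 - ρ - c) <| by
      rintro _ ⟨_, ⟨x, hx, rfl⟩, rfl⟩
      exact ⟨h x, hmem x hx, by simp only [hc]; ring⟩
    refine ⟨a, 1 - b, ha, rightIsolated_of_leftIsolated_image (by rwa [sub_sub_cancel]),
      fun _ => ⟨by rwa [hc], rightIsolated_of_leftIsolated_image ?_⟩, fun h3 => absurd h3 h2⟩
    rw [hc]
    convert hb' using 1
    ring
  by_cases h2 : ∃ c : ℝ, ∀ x, h x = -ρ * x + c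
  · obtain ⟨c, hc⟩ := h2
    obtain ⟨a, ha, ha'⟩ := hE.exists_leftIsolated_map hn hR hα hpos hfinR hρ0 hρ1
        (c := 1 - c) <| by
      rintro _ ⟨x, hx, rfl⟩
      exact ⟨h x, hmem x hx, by simp only [hc]; ring⟩
    obtain ⟨b, hb, hb'⟩ := hR.exists_leftIsolated_map hn hE hα hposR hfin hρ0 hρ1
        (c := c - ρ) <| by
      rintro _ ⟨_, ⟨x, hx, rfl⟩, rfl⟩
      convert hmem x hx using 1
      rw [hc]
      ring
    refine ⟨a, 1 - b, ha, rightIsolated_of_leftIsolated_image (by rwa [sub_sub_cancel]),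
      fun h3 => absurd h3 h1, fun _ => ⟨?_, rightIsolated_of_leftIsolated_image ?_⟩⟩
    · rw [hc]
      convert hb' using 1
      ring
    · rw [hc]
      convert ha' using 1
      ring
  · obtain ⟨a, haE, ha⟩ := hE.isCompact.exists_isLeast hne
    obtain ⟨b, hbE, hb⟩ := hE.isCompact.exists_isGreatest hne
    refine ⟨a, b, ⟨haE, 1, one_pos, Set.eq_empty_of_forall_notMem ?_⟩,
      ⟨hbE, 1, one_pos, Set.eq_empty_of_forall_notMem ?_⟩,
      fun h3 => absurd h3 h1, fun h3 => absurd h3 h2⟩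
    · exact fun x hx => absurd (ha hx.2) (not_le.mpr hx.1.2)
    · exact fun x hx => absurd (hb hx.2) (not_le.mpr hx.1.1)

theorem mem_rowDigits {Λ : Finset (ℕ × ℕ)} {i j : ℕ} : i ∈ rowDigits Λ j ↔ (i, j) ∈ Λ := by
  simp [rowDigits]

theorem mem_horizSlice_iff {n m : ℕ} {Λ : Finset (ℕ × ℕ)} {x y : ℝ} :
    x ∈ horizSlice (BMCarpet n m Λ) y ↔
      ∃ j, digitSum m j = y ∧ x ∈ digitSet n fun k => rowDigits Λ (j k) := by
  constructor
  · rintro ⟨d, hd, hx, hy⟩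
    exact ⟨fun k => (d k).2, hy.symm, fun k => (d k).1, fun k => mem_rowDigits.mpr (hd k), hx.symm⟩
  · rintro ⟨j, hy, i, hi, hx⟩
    exact ⟨fun k => (i k, j k), fun k => mem_rowDigits.mp (hi k), hx.symm, hy.symm⟩

theorem properDigits_rowDigits {n m : ℕ} {Λ : Finset (ℕ × ℕ)} (hn : 0 < n)
    (hΛ : Λ ⊆ Finset.range n ×ˢ Finset.range m) (hN : maxRowCard m Λ ≤ n - 1) {j : ℕ → ℕ}
    (hj : ∀ k, (rowDigits Λ (j k)).Nonempty) : ProperDigits n fun k => rowDigits Λ (j k) := by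
  refine fun k => ⟨hj k, Finset.ssubset_iff_subset_ne.mpr ⟨fun i hi => ?_, fun heq => ?_⟩⟩
  · exact (Finset.mem_product.mp (hΛ (mem_rowDigits.mp hi))).1
  · obtain ⟨i, hi⟩ := hj k
    have h1 : (rowDigits Λ (j k)).card ≤ maxRowCard m Λ :=
      Finset.le_sup (f := fun j => (rowDigits Λ j).card)
        (Finset.mem_product.mp (hΛ (mem_rowDigits.mp hi))).2
    rw [show rowDigits Λ (j k) = _ from heq, Finset.card_range] at h1
    omega

theorem isSliceModel_horizSlice {n m : ℕ} {Λ : Finset (ℕ × ℕ)} {y : ℝ} (hn : 0 < n) (hm : 2 ≤ m)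
    (hΛ : Λ ⊆ Finset.range n ×ˢ Finset.range m) (hN : maxRowCard m Λ ≤ n - 1)
    (hne : (horizSlice (BMCarpet n m Λ) y).Nonempty) :
    IsSliceModel n (horizSlice (BMCarpet n m Λ) y) := by
  have hrow : ∀ {j : ℕ → ℕ} {x}, x ∈ (digitSet n fun k => rowDigits Λ (j k)) →
      ∀ k, (rowDigits Λ (j k)).Nonempty := fun ⟨i, hi, _⟩ k => ⟨i k, hi k⟩
  have hlt : ∀ {j : ℕ → ℕ}, (∀ k, (rowDigits Λ (j k)).Nonempty) → ∀ k, j k < m := by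
    intro j hj k
    obtain ⟨i, hi⟩ := hj k
    exact Finset.mem_range.mp (Finset.mem_product.mp (hΛ (mem_rowDigits.mp hi))).2
  have hconst : ∀ (j : ℕ → ℕ) (k v : ℕ), (∀ l, k < l → j l = v) →
      EventuallyConst fun k => rowDigits Λ (j k) := by
    refine fun j k v h => ⟨k + 1, fun l hl => ?_⟩
    simp only [h l (by omega), h (k + 1) (by omega)]
  obtain ⟨x₀, hx₀⟩ := hne
  obtain ⟨j, hjy, hxj⟩ := mem_horizSlice_iff.mp hx₀
  have hj := hrow hxj
  by_cases huniq : ∀ j', digitSum m j' = y → (∀ k, (rowDigits Λ (j' k)).Nonempty) → j' = j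
  · refine Or.inl ⟨_, properDigits_rowDigits hn hΛ hN hj, ?_⟩
    ext x
    rw [mem_horizSlice_iff]
    constructor
    · rintro ⟨j', hy', hx⟩
      rwa [← huniq j' hy' (hrow hx)]
    · exact fun hx => ⟨j, hjy, hx⟩
  · push Not at huniq
    obtain ⟨j', hjy', hj', hne⟩ := huniq
    have hpair : ∀ {d e : ℕ → ℕ}, digitSum m d = y → digitSum m e = y →
        (∀ k, (rowDigits Λ (d k)).Nonempty) → (∀ k, (rowDigits Λ (e k)).Nonempty) → d ≠ e →
        ∃ k, (∀ l, k < l → d l = 0 ∧ e l = m - 1) ∨ ∀ l, k < l → e l = 0 ∧ d l = m - 1 :=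
      fun hd he hd' he' => digits_of_digitSum_eq hm (hlt hd') (hlt he') (hd.trans he.symm)
    obtain ⟨k, hk⟩ := hpair hjy' hjy hj' hj hne
    have honly : ∀ e, digitSum m e = y → (∀ k, (rowDigits Λ (e k)).Nonempty) → e = j ∨ e = j' := by
      intro e hey he
      by_contra! hcon
      obtain ⟨k₁, hk₁⟩ := hpair hey hjy he hj hcon.1
      obtain ⟨k₂, hk₂⟩ := hpair hey hjy' he hj' hcon.2
      have h0 := hk.imp (fun h => h (k + k₁ + k₂ + 1) (by omega))
        fun h => h (k + k₁ + k₂ + 1) (by omega)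
      have h1 := hk₁.imp (fun h => h (k + k₁ + k₂ + 1) (by omega))
        fun h => h (k + k₁ + k₂ + 1) (by omega)
      have h2 := hk₂.imp (fun h => h (k + k₁ + k₂ + 1) (by omega))
        fun h => h (k + k₁ + k₂ + 1) (by omega)
      omega
    refine Or.inr ⟨_, _, properDigits_rowDigits hn hΛ hN hj, properDigits_rowDigits hn hΛ hN hj',
      ?_, ?_, ?_⟩
    · rcases hk with hk | hk
      · exact hconst j k _ fun l hl => (hk l hl).2
      · exact hconst j k _ fun l hl => (hk l hl).1
    · rcases hk with hk | hk
      · exact hconst j' k _ fun l hl => (hk l hl).1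
      · exact hconst j' k _ fun l hl => (hk l hl).2
    · ext x
      rw [mem_horizSlice_iff]
      constructor
      · rintro ⟨e, hey, hx⟩
        rcases honly e hey (hrow hx) with rfl | rfl
        · exact Or.inl hx
        · exact Or.inr hx
      · rintro (hx | hx)
        · exact ⟨j, hjy, hx⟩
        · exact ⟨j', hjy', hx⟩

theorem isolated_points_map_to_isolated_points
    (n m : ℕ) (Λ : Finset (ℕ × ℕ))
    (hm : 2 ≤ m) (hnm : m < n)
    (hΛsub : Λ ⊆ Finset.range n ×ˢ Finset.range m)
    (hΛ1 : 1 < Λ.card) (hΛ2 : Λ.card < m * n)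
    (hN2 : 2 ≤ maxRowCard m Λ) (hNn : maxRowCard m Λ ≤ n - 1)
    (y : ℝ) (hy : y ∈ Prod.snd '' BMCarpet n m Λ)
    (α : ℝ) (hα : α = Real.log (maxRowCard m Λ) / Real.log n)
    (hpos : 0 < μH[α] (horizSlice (BMCarpet n m Λ) y))
    (hfin : μH[α] (horizSlice (BMCarpet n m Λ) y) < ⊤)
    (h : ℝ → ℝ) (ρ : ℝ) (hρ0 : 0 < ρ) (hρ1 : ρ < 1)
    (hsim : ∀ x x' : ℝ, |h x - h x'| = ρ * |x - x'|)
    (hsub : h '' horizSlice (BMCarpet n m Λ) y ⊆ horizSlice (BMCarpet n m Λ) y) :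
    ∃ a b : ℝ,
      LeftIsolated (horizSlice (BMCarpet n m Λ) y) a ∧
      RightIsolated (horizSlice (BMCarpet n m Λ) y) b ∧
      ((∃ c : ℝ, ∀ x, h x = ρ * x + c) →
        LeftIsolated (horizSlice (BMCarpet n m Λ) y) (h a) ∧
        RightIsolated (horizSlice (BMCarpet n m Λ) y) (h b)) ∧
      ((∃ c : ℝ, ∀ x, h x = -ρ * x + c) →
        LeftIsolated (horizSlice (BMCarpet n m Λ) y) (h b) ∧
        RightIsolated (horizSlice (BMCarpet n m Λ) y) (h a)) := by
  have hne : (horizSlice (BMCarpet n m Λ) y).Nonempty := by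
    obtain ⟨⟨x, _⟩, hx, rfl⟩ := hy
    exact ⟨x, hx⟩
  have hα0 : 0 ≤ α := by
    rw [hα]
    exact div_nonneg (Real.log_natCast_nonneg _) (Real.log_natCast_nonneg _)
  exact (isSliceModel_horizSlice (by omega) hm hΛsub hNn hne).exists_isolated_map (by omega) hne
    hα0 hpos hfin hρ0 hρ1 hsub
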